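/- For every Γ > 1 and all pairs (σ,ω) of locally finite positive Borel measures on ℝ^n, N_M(σ,ω) ≈ T_M(Γ)(σ,ω) + √(A₂(σ,ω)), with implicit constants of comparability depending only on Γ and the dimension n. -/

import Mathlib

open MeasureTheory Set Filter
open scoped ENNReal NNReal

noncomputable section

/-- An axis-parallel half-open cube in `ℝⁿ`, given by its lower corner and (positive)
side length. -/
structure Cube (n : ℕ) where
  corner : Fin n → ℝ
  side : ℝ
  side_pos : 0 < side

namespace Cube

variable {n : ℕ}

/-- The underlying (half-open) set of the cube. -/
def toSet (Q : Cube n) : Set (Fin n → ℝ) :=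
  {x | ∀ i, Q.corner i ≤ x i ∧ x i < Q.corner i + Q.side}

/-- The concentric dilate `ΓQ` of the cube `Q` (same center, side length `Γ·ℓ(Q)`),
as a set. -/
def dilate (Q : Cube n) (Γ : ℝ) : Set (Fin n → ℝ) :=
  {x | ∀ i, Q.corner i - (Γ - 1) * Q.side / 2 ≤ x i ∧
       x i < Q.corner i + Q.side + (Γ - 1) * Q.side / 2}

/-- Membership in `𝒫ⁿ`: the side length is an integral power of `2`. -/
def memP (Q : Cube n) : Prop := ∃ ℓ : ℤ, Q.side = (2:ℝ) ^ ℓ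

end Cube

/-- The translation applied at scale `2^ℓ` in the random dyadic grid determined by `β`:
`Σ_{j : 2^{-j} < 2^ℓ} 2^{-j} β_j`. -/
def gridShift {n : ℕ} (β : ℤ → Fin n → Bool) (ℓ : ℤ) (i : Fin n) : ℝ :=
  ∑' j : ℤ, if (2:ℝ) ^ (-j) < (2:ℝ) ^ ℓ ∧ β j i = true then (2:ℝ) ^ (-j) else 0

/-- Membership in the shifted dyadic grid `𝒟^β`. -/
def memGrid {n : ℕ} (β : ℤ → Fin n → Bool) (Q : Cube n) : Prop :=
  ∃ (ℓ : ℤ) (k : Fin n → ℤ), Q.side = (2:ℝ) ^ ℓ ∧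
    ∀ i, Q.corner i = (2:ℝ) ^ ℓ * (k i : ℝ) + gridShift β ℓ i

/-- The Hardy–Littlewood maximal function of a measure, over cubes in `𝒫ⁿ`. -/
def maximal {n : ℕ} (μ : Measure (Fin n → ℝ)) (x : Fin n → ℝ) : ℝ≥0∞ :=
  ⨆ (Q : Cube n) (_ : Q.memP) (_ : x ∈ Q.toSet), μ Q.toSet / volume Q.toSet

/-- The dyadic maximal function relative to the grid `𝒟^β`. -/
def dyadicMaximal {n : ℕ} (β : ℤ → Fin n → Bool) (μ : Measure (Fin n → ℝ))
    (x : Fin n → ℝ) : ℝ≥0∞ :=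
  ⨆ (Q : Cube n) (_ : memGrid β Q) (_ : x ∈ Q.toSet), μ Q.toSet / volume Q.toSet

/-- The two-weight Muckenhoupt constant `A₂(σ,ω)`. -/
def A2 {n : ℕ} (σ ω : Measure (Fin n → ℝ)) : ℝ≥0∞ :=
  ⨆ (Q : Cube n) (_ : Q.memP), (σ Q.toSet / volume Q.toSet) * (ω Q.toSet / volume Q.toSet)

/-- The operator norm `𝔑_M(σ,ω)` of the maximal function from `L²(σ)` to `L²(ω)`:
the least `N` with `∫ M(fσ)² dω ≤ N² ∫ f² dσ` for all (nonnegative) `f`. -/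
def opNorm {n : ℕ} (σ ω : Measure (Fin n → ℝ)) : ℝ≥0∞ :=
  sInf {N : ℝ≥0∞ | ∀ f : (Fin n → ℝ) → ℝ≥0∞, Measurable f →
    ∫⁻ x, (maximal (σ.withDensity f) x) ^ 2 ∂ω ≤ N ^ 2 * ∫⁻ x, (f x) ^ 2 ∂σ}

/-- The `Γ`-testing constant `𝔗_M(Γ)(σ,ω)`: the least `T` with
`∫_Q M(1_Q σ)² dω ≤ T² σ(ΓQ)` for all `Q ∈ 𝒫ⁿ`. -/
def testGamma {n : ℕ} (Γ : ℝ) (σ ω : Measure (Fin n → ℝ)) : ℝ≥0∞ :=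
  sInf {T : ℝ≥0∞ | ∀ Q : Cube n, Q.memP →
    ∫⁻ x in Q.toSet, (maximal (σ.restrict Q.toSet) x) ^ 2 ∂ω ≤ T ^ 2 * σ (Q.dilate Γ)}

namespace Cube

variable {n : ℕ}

theorem toSet_eq_pi (Q : Cube n) :
    Q.toSet = Set.univ.pi fun i => Set.Ico (Q.corner i) (Q.corner i + Q.side) := by
  ext x
  simp [toSet, Set.mem_pi]

theorem measurableSet_toSet (Q : Cube n) : MeasurableSet Q.toSet := by
  rw [toSet_eq_pi]
  exact MeasurableSet.univ_pi fun _ => measurableSet_Ico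

theorem volume_toSet (Q : Cube n) : volume Q.toSet = ENNReal.ofReal Q.side ^ n := by
  rw [toSet_eq_pi, Real.volume_pi_Ico]
  simp

theorem measure_ne_top (Q : Cube n) (μ : Measure (Fin n → ℝ)) [IsLocallyFiniteMeasure μ] :
    μ Q.toSet ≠ ∞ := by
  have h : Q.toSet ⊆ Set.Icc Q.corner (fun i => Q.corner i + Q.side) :=
    fun x hx => ⟨fun i => (hx i).1, fun i => (hx i).2.le⟩
  exact ((measure_mono h).trans_lt isCompact_Icc.measure_lt_top).ne

/-- The concentric dilate of a cube, as a cube. -/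
def expand (Q : Cube n) (r : ℝ) (hr : 0 < r) : Cube n where
  corner i := Q.corner i - (r - 1) * Q.side / 2
  side := r * Q.side
  side_pos := mul_pos hr Q.side_pos

theorem toSet_expand (Q : Cube n) (r : ℝ) (hr : 0 < r) :
    (Q.expand r hr).toSet = Q.dilate r := by
  ext x
  simp only [toSet, dilate, expand, Set.mem_ofPred_eq]
  refine forall_congr' fun i => and_congr Iff.rfl ?_
  rw [show Q.corner i - (r - 1) * Q.side / 2 + r * Q.side
    = Q.corner i + Q.side + (r - 1) * Q.side / 2 by ring]

theorem dilate_expand (Q : Cube n) (r s : ℝ) (hr : 0 < r) :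
    (Q.expand r hr).dilate s = Q.dilate (r * s) := by
  ext x
  simp only [dilate, expand, Set.mem_ofPred_eq]
  refine forall_congr' fun i => ?_
  rw [show Q.corner i - (r - 1) * Q.side / 2 - (s - 1) * (r * Q.side) / 2
      = Q.corner i - (r * s - 1) * Q.side / 2 by ring,
    show Q.corner i - (r - 1) * Q.side / 2 + r * Q.side + (s - 1) * (r * Q.side) / 2
      = Q.corner i + Q.side + (r * s - 1) * Q.side / 2 by ring]

theorem dilate_mono (Q : Cube n) {r s : ℝ} (h : r ≤ s) : Q.dilate r ⊆ Q.dilate s := by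
  intro x hx i
  have h₁ := hx i
  have h₂ := mul_le_mul_of_nonneg_right h Q.side_pos.le
  constructor <;> linarith

theorem toSet_eq_dilate (Q : Cube n) : Q.toSet = Q.dilate 1 := by
  ext x
  simp [toSet, dilate]

theorem toSet_subset_dilate (Q : Cube n) {r : ℝ} (h : 1 ≤ r) : Q.toSet ⊆ Q.dilate r :=
  Q.toSet_eq_dilate ▸ Q.dilate_mono h

theorem measurableSet_dilate (Q : Cube n) {r : ℝ} (hr : 0 < r) : MeasurableSet (Q.dilate r) :=
  Q.toSet_expand r hr ▸ measurableSet_toSet _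

theorem measure_dilate_ne_top (Q : Cube n) {r : ℝ} (hr : 0 < r) (μ : Measure (Fin n → ℝ))
    [IsLocallyFiniteMeasure μ] : μ (Q.dilate r) ≠ ∞ :=
  Q.toSet_expand r hr ▸ measure_ne_top _ μ

theorem memP.expand {Q : Cube n} (hQ : Q.memP) (p : ℕ) (h : (0 : ℝ) < 2 ^ p) :
    (Q.expand (2 ^ p) h).memP := by
  obtain ⟨ℓ, hℓ⟩ := hQ
  refine ⟨p + ℓ, ?_⟩
  rw [zpow_add₀ two_ne_zero, ← hℓ]
  rfl

theorem volume_expand (Q : Cube n) (p : ℕ) (h : (0 : ℝ) < 2 ^ p) :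
    volume (Q.expand (2 ^ p) h).toSet = 2 ^ (p * n) * volume Q.toSet := by
  rw [volume_toSet, volume_toSet, pow_mul, ← mul_pow]
  congr 1
  rw [Cube.expand, ENNReal.ofReal_mul h.le, ENNReal.ofReal_pow zero_le_two, ENNReal.ofReal_ofNat]

/-- Containment of cubes, in terms of corners and side lengths. -/
def Within (q Q : Cube n) : Prop :=
  q.side ≤ Q.side ∧ ∀ i, Q.corner i ≤ q.corner i ∧ q.corner i + q.side ≤ Q.corner i + Q.side

theorem Within.trans {a b c : Cube n} (h : a.Within b) (h' : b.Within c) : a.Within c :=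
  ⟨h.1.trans h'.1, fun i => ⟨(h'.2 i).1.trans (h.2 i).1, (h.2 i).2.trans (h'.2 i).2⟩⟩

theorem Within.refl (a : Cube n) : a.Within a := ⟨le_rfl, fun _ => ⟨le_rfl, le_rfl⟩⟩

theorem Within.dilate_subset {q Q : Cube n} (h : q.Within Q) {r : ℝ} (hr : 1 ≤ r) :
    q.dilate r ⊆ Q.dilate r := by
  intro x hx i
  have h₁ := hx i
  have h₂ := h.2 i
  have h₃ := mul_le_mul_of_nonneg_left h.1 (sub_nonneg.2 hr)
  constructor <;> linarith

theorem Within.dilate_subset_of_side_le {q Q : Cube n} (h : q.Within Q) {r : ℝ}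
    (hr : r * q.side ≤ 3 * Q.side) : q.dilate r ⊆ Q.dilate 8 := by
  intro x hx i
  have h₁ := hx i
  have h₂ := h.2 i
  have h₃ := q.side_pos
  have h₄ := Q.side_pos
  constructor <;> linarith

/-- The standard dyadic cube with side length `2 ^ q.1` and lower corner `2 ^ q.1 • q.2`. -/
def dyadic (q : ℤ × (Fin n → ℤ)) : Cube n where
  corner i := 2 ^ q.1 * q.2 i
  side := 2 ^ q.1
  side_pos := by positivity

theorem memP_dyadic (q : ℤ × (Fin n → ℤ)) : (dyadic q).memP := ⟨q.1, rfl⟩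

theorem dyadic_within {q r : ℤ × (Fin n → ℤ)} (h : q.1 ≤ r.1) {x : Fin n → ℝ}
    (hq : x ∈ (dyadic q).toSet) (hr : x ∈ (dyadic r).toSet) : (dyadic q).Within (dyadic r) := by
  refine ⟨zpow_le_zpow_right₀ one_le_two h, fun i => ?_⟩
  obtain ⟨d, hd⟩ := Int.eq_ofNat_of_zero_le (sub_nonneg.2 h)
  have hpos : (0 : ℝ) < 2 ^ q.1 := by positivity
  have hside : (2 : ℝ) ^ r.1 = 2 ^ q.1 * ((2 ^ d : ℤ) : ℝ) := by
    rw [show r.1 = q.1 + d by lia, zpow_add₀ two_ne_zero]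
    simp
  have h₁ := hq i
  have h₂ := hr i
  simp only [dyadic, hside] at h₁ h₂ ⊢
  generalize (2 ^ d : ℤ) = N at *
  have h₃ : N * r.2 i < q.2 i + 1 := by
    have : (2 : ℝ) ^ q.1 * (N * r.2 i) < 2 ^ q.1 * (q.2 i + 1) := by linarith
    exact_mod_cast lt_of_mul_lt_mul_left this hpos.le
  have h₄ : q.2 i < N * r.2 i + N := by
    have : (2 : ℝ) ^ q.1 * q.2 i < 2 ^ q.1 * (N * r.2 i + N) := by linarith
    exact_mod_cast lt_of_mul_lt_mul_left this hpos.le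
  have h₅ : ((N * r.2 i : ℤ) : ℝ) ≤ q.2 i := by exact_mod_cast Int.lt_add_one_iff.1 h₃
  have h₆ : ((q.2 i + 1 : ℤ) : ℝ) ≤ (N * r.2 i + N : ℤ) := by exact_mod_cast h₄
  push_cast at h₅ h₆
  have h₇ := mul_le_mul_of_nonneg_left h₅ hpos.le
  have h₈ := mul_le_mul_of_nonneg_left h₆ hpos.le
  constructor <;> linarith

theorem le_of_dyadic_within {q r : ℤ × (Fin n → ℤ)} (h : (dyadic q).Within (dyadic r)) :
    q.1 ≤ r.1 :=
  (zpow_le_zpow_iff_right₀ one_lt_two).1 h.1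

theorem dyadic_within_antisymm {q r : ℤ × (Fin n → ℤ)} (h : (dyadic q).Within (dyadic r))
    (h' : r.1 ≤ q.1) : r = q := by
  have hk : q.1 = r.1 := (le_of_dyadic_within h).antisymm h'
  refine Prod.ext hk.symm (funext fun i => ?_)
  have hpos : (0 : ℝ) < 2 ^ r.1 := by positivity
  have h₁ := h.2 i
  simp only [dyadic, hk] at h₁
  have h₂ : (2 : ℝ) ^ r.1 * r.2 i = 2 ^ r.1 * q.2 i := by linarith
  exact_mod_cast mul_left_cancel₀ hpos.ne' h₂

/-- Every finite family of dyadic cubes has a disjoint subfamily (its maximal members) such that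
each member of the family lies within a member of the subfamily. -/
theorem exists_disjoint_maximal (S : Finset (ℤ × (Fin n → ℤ))) :
    ∃ S' ⊆ S, (S' : Set (ℤ × (Fin n → ℤ))).PairwiseDisjoint (fun q => (dyadic q).toSet) ∧
      ∀ q ∈ S, ∃ r ∈ S', (dyadic q).Within (dyadic r) := by
  classical
  refine ⟨S.filter fun q => ∀ r ∈ S, (dyadic q).Within (dyadic r) → r = q,
    Finset.filter_subset _ _, ?_, fun q hq => ?_⟩
  · intro q hq r hr hne
    rw [Finset.mem_coe, Finset.mem_filter] at hq hr
    refine Set.disjoint_left.2 fun x hxq hxr => hne ?_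
    rcases le_total q.1 r.1 with h | h
    · exact (hq.2 r hr.1 (dyadic_within h hxq hxr)).symm
    · exact hr.2 q hq.1 (dyadic_within h hxr hxq)
  · obtain ⟨r, hr, hmax⟩ := (S.filter fun r => (dyadic q).Within (dyadic r)).exists_max_image
      Prod.fst ⟨q, Finset.mem_filter.2 ⟨hq, Within.refl _⟩⟩
    rw [Finset.mem_filter] at hr
    refine ⟨r, Finset.mem_filter.2 ⟨hr.1, fun s hs hrs => ?_⟩, hr.2⟩
    exact dyadic_within_antisymm hrs (hmax s (Finset.mem_filter.2 ⟨hs, hr.2.trans hrs⟩))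

/-- The average of a measure over a cube is controlled by averages over adjacent dyadic cubes of
the same side length. -/
theorem average_le_of_dyadic (μ : Measure (Fin n → ℝ)) {P : Cube n} (hP : P.memP)
    {x : Fin n → ℝ} (hx : x ∈ P.toSet) {g : ℝ≥0∞}
    (hg : ∀ q, x ∈ (dyadic q).dilate 3 → μ (dyadic q).toSet / volume (dyadic q).toSet ≤ g) :
    μ P.toSet / volume P.toSet ≤ 2 ^ n * g := by
  obtain ⟨k, hk⟩ := hP
  have hpos : (0 : ℝ) < 2 ^ k := by positivity
  let m : Fin n → ℤ := fun i => ⌊P.corner i / 2 ^ k⌋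
  have hm : ∀ i, (2 : ℝ) ^ k * m i ≤ P.corner i ∧ P.corner i < 2 ^ k * m i + 2 ^ k := by
    intro i
    have h₁ := Int.floor_le (P.corner i / 2 ^ k)
    have h₂ := Int.lt_floor_add_one (P.corner i / 2 ^ k)
    rw [le_div_iff₀ hpos] at h₁
    rw [div_lt_iff₀ hpos] at h₂
    constructor <;> simp only [m] <;> linarith
  let Q : (Fin n → Bool) → ℤ × (Fin n → ℤ) := fun ε => (k, fun i => m i + if ε i then 1 else 0)
  have hcover : P.toSet ⊆ ⋃ ε, (dyadic (Q ε)).toSet := by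
    intro y hy
    refine Set.mem_iUnion.2 ⟨fun i => decide ((2 : ℝ) ^ k * m i + 2 ^ k ≤ y i), fun i => ?_⟩
    have h₁ := hy i
    have h₂ := hm i
    rw [hk] at h₁
    by_cases h : (2 : ℝ) ^ k * m i + 2 ^ k ≤ y i
    · simp only [dyadic, Q, h, decide_true, if_true]
      push_cast
      constructor <;> linarith
    · simp only [dyadic, Q, h, decide_false, Bool.false_eq_true, if_false]
      push_cast
      constructor <;> linarith
  have hvol : ∀ ε, volume (dyadic (Q ε)).toSet = volume P.toSet := fun ε => by
    rw [volume_toSet, volume_toSet, hk]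
    rfl
  have hnear : ∀ ε, x ∈ (dyadic (Q ε)).dilate 3 := by
    intro ε i
    have h₁ := hx i
    have h₂ := hm i
    rw [hk] at h₁
    by_cases h : ε i
    · simp only [dyadic, Q, h, if_true]
      push_cast
      constructor <;> linarith
    · simp only [dyadic, Q, h, Bool.false_eq_true, if_false]
      push_cast
      constructor <;> linarith
  calc μ P.toSet / volume P.toSet
      ≤ (∑ ε, μ (dyadic (Q ε)).toSet) / volume P.toSet := by
        gcongr
        exact (measure_mono hcover).trans (measure_iUnion_fintype_le _ _)
    _ = ∑ ε, μ (dyadic (Q ε)).toSet / volume (dyadic (Q ε)).toSet := by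
        simp_rw [hvol, div_eq_mul_inv, Finset.sum_mul]
    _ ≤ ∑ _ε : Fin n → Bool, g := Finset.sum_le_sum fun ε _ => hg _ (hnear ε)
    _ = 2 ^ n * g := by simp

end Cube

section MaximalEstimates

variable {n : ℕ}

open Cube

theorem le_maximal (μ : Measure (Fin n → ℝ)) {Q : Cube n} (hQ : Q.memP) {x : Fin n → ℝ}
    (hx : x ∈ Q.toSet) : μ Q.toSet / volume Q.toSet ≤ maximal μ x :=
  le_iSup₂_of_le Q hQ (le_iSup_of_le hx le_rfl)

theorem average_mul_average_le_A2 (σ ω : Measure (Fin n → ℝ)) {Q : Cube n} (hQ : Q.memP) :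
    (σ Q.toSet / volume Q.toSet) * (ω Q.toSet / volume Q.toSet) ≤ A2 σ ω :=
  le_iSup₂_of_le Q hQ le_rfl

/-- The average over a dilated subcube `q` of `Q` is controlled either by the maximal function
of `σ` localized to `8Q`, or by the average over the dilate of `Q`. -/
theorem dilate_average_sq_le (σ : Measure (Fin n → ℝ)) {Λ : ℝ} (hΛ : 3 ≤ Λ) {p : ℕ}
    (hp : Λ ≤ 2 ^ p) {q Q : Cube n} (hq : q.memP) (h : q.Within Q) {x : Fin n → ℝ}
    (hx : x ∈ q.dilate 3) :
    (σ (q.dilate Λ) / volume q.toSet) ^ 2 ≤ (2 ^ (p * n)) ^ 2 *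
      (maximal (σ.restrict (Q.dilate 8)) x ^ 2 + (σ (Q.dilate Λ) / volume Q.toSet) ^ 2) := by
  have h2p : (0 : ℝ) < 2 ^ p := by positivity
  have hB : (2 ^ (p * n) : ℝ≥0∞) ≠ 0 := by simp
  have hB' : (2 ^ (p * n) : ℝ≥0∞) ≠ ∞ := by finiteness
  rw [mul_add, ← mul_pow, ← mul_pow]
  rcases le_or_gt (2 ^ p * q.side) (3 * Q.side) with hs | hs
  · refine le_add_right (pow_le_pow_left₀ zero_le ?_ 2)
    have hsub : q.dilate (2 ^ p) ⊆ Q.dilate 8 := h.dilate_subset_of_side_le hs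
    have hM := le_maximal (σ.restrict (Q.dilate 8)) (hq.expand p h2p) (x := x)
      (by rw [toSet_expand]; exact q.dilate_mono (hΛ.trans hp) hx)
    rw [volume_expand, toSet_expand, Measure.restrict_eq_self _ hsub] at hM
    calc σ (q.dilate Λ) / volume q.toSet
        ≤ σ (q.dilate (2 ^ p)) / volume q.toSet := by
          gcongr
          exact q.dilate_mono hp
      _ = 2 ^ (p * n) * (σ (q.dilate (2 ^ p)) / (2 ^ (p * n) * volume q.toSet)) := by
          rw [← mul_div_assoc, ENNReal.mul_div_mul_left _ _ hB hB']
      _ ≤ _ := by gcongr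
  · refine le_add_left (pow_le_pow_left₀ zero_le ?_ 2)
    have hv : volume Q.toSet ≤ 2 ^ (p * n) * volume q.toSet := by
      rw [← volume_expand q p h2p, volume_toSet, volume_toSet]
      gcongr
      change Q.side ≤ 2 ^ p * q.side
      linarith [Q.side_pos]
    calc σ (q.dilate Λ) / volume q.toSet
        ≤ σ (Q.dilate Λ) / volume q.toSet := by
          gcongr
          exact h.dilate_subset (by linarith)
      _ = 2 ^ (p * n) * (σ (Q.dilate Λ) / (2 ^ (p * n) * volume q.toSet)) := by
          rw [← mul_div_assoc, ENNReal.mul_div_mul_left _ _ hB hB']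
      _ ≤ _ := by gcongr

theorem average_sq_mul_le_A2 (σ ω : Measure (Fin n → ℝ))
    {Λ : ℝ} (hΛ : 3 ≤ Λ) {p : ℕ} (hp : Λ ≤ 2 ^ p) {Q : Cube n} (hQ : Q.memP) :
    (σ (Q.dilate Λ) / volume Q.toSet) ^ 2 * ω (Q.dilate 3) ≤
      (2 ^ (p * n)) ^ 2 * A2 σ ω * σ (Q.dilate Λ) := by
  have h2p : (0 : ℝ) < 2 ^ p := by positivity
  have hB : (2 ^ (p * n) : ℝ≥0∞) ≠ 0 := by simp
  have hB' : (2 ^ (p * n) : ℝ≥0∞) ≠ ∞ := by finiteness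
  have hA := average_mul_average_le_A2 σ ω (hQ.expand p h2p)
  rw [volume_expand, toSet_expand] at hA
  have hscale : ∀ a : ℝ≥0∞,
      a / volume Q.toSet = 2 ^ (p * n) * (a / (2 ^ (p * n) * volume Q.toSet)) := fun a => by
    rw [← mul_div_assoc, ENNReal.mul_div_mul_left _ _ hB hB']
  calc (σ (Q.dilate Λ) / volume Q.toSet) ^ 2 * ω (Q.dilate 3)
      = (σ (Q.dilate Λ) / volume Q.toSet) * (ω (Q.dilate 3) / volume Q.toSet) *
          σ (Q.dilate Λ) := by
        simp only [div_eq_mul_inv]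
        ring
    _ ≤ (σ (Q.dilate (2 ^ p)) / volume Q.toSet) * (ω (Q.dilate (2 ^ p)) / volume Q.toSet) *
          σ (Q.dilate Λ) := by
        gcongr
        · exact Q.dilate_mono hp
        · exact Q.dilate_mono (hΛ.trans hp)
    _ = (2 ^ (p * n)) ^ 2 * ((σ (Q.dilate (2 ^ p)) / (2 ^ (p * n) * volume Q.toSet)) *
          (ω (Q.dilate (2 ^ p)) / (2 ^ (p * n) * volume Q.toSet))) * σ (Q.dilate Λ) := by
        rw [hscale, hscale (ω _)]
        ring
    _ ≤ _ := by gcongr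

/-- The Carleson-type packing estimate following from `Γ`-testing and the `A₂` condition. -/
theorem setLIntegral_localized_le (σ ω : Measure (Fin n → ℝ))
    {Γ : ℝ} (hΓ : 1 < Γ) {T : ℝ≥0∞}
    (hT : ∀ Q : Cube n, Q.memP →
      ∫⁻ x in Q.toSet, (maximal (σ.restrict Q.toSet) x) ^ 2 ∂ω ≤ T ^ 2 * σ (Q.dilate Γ))
    {p : ℕ} (hp : 8 * Γ ≤ 2 ^ p) {Q : Cube n} (hQ : Q.memP) :
    ∫⁻ x in Q.dilate 3, (2 ^ (p * n)) ^ 2 * (maximal (σ.restrict (Q.dilate 8)) x ^ 2 +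
      (σ (Q.dilate (8 * Γ)) / volume Q.toSet) ^ 2) ∂ω ≤
      (2 ^ (p * n)) ^ 2 * (T ^ 2 + (2 ^ (p * n)) ^ 2 * A2 σ ω) * σ (Q.dilate (8 * Γ)) := by
  rw [lintegral_const_mul' _ _ (by finiteness), lintegral_add_right _ measurable_const,
    lintegral_const, Measure.restrict_apply_univ, mul_assoc, add_mul]
  refine mul_le_mul_right (add_le_add ?_ ?_) _
  · refine (lintegral_mono_set (Q.dilate_mono (by norm_num : (3 : ℝ) ≤ 8))).trans ?_
    have h := hT (Q.expand (2 ^ 3) (by positivity)) (hQ.expand 3 (by positivity))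
    rw [dilate_expand, toSet_expand] at h
    norm_num at h
    exact h
  · exact average_sq_mul_le_A2 σ ω (by linarith) hp hQ

theorem sq_le_lintegral_layers (a : ℝ≥0∞) :
    a ^ 2 ≤ 4 * ∫⁻ t in Set.Ioi (0 : ℝ),
      ENNReal.ofReal t * (if ENNReal.ofReal t < a then 1 else 0) := by
  have key : ∀ b : ℝ≥0, (b : ℝ≥0∞) ≤ a → (b : ℝ≥0∞) ^ 2 ≤ 4 * ∫⁻ t in Set.Ioi (0 : ℝ),
      ENNReal.ofReal t * (if ENNReal.ofReal t < a then 1 else 0) := by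
    intro b hb
    have hsub : Set.Ico ((b : ℝ) / 2) b ∩ Set.Ioi 0 ⊆ Set.Ioi (0 : ℝ) := Set.inter_subset_right
    have hvol : volume (Set.Ico ((b : ℝ) / 2) b ∩ Set.Ioi 0) = ENNReal.ofReal (b / 2) := by
      rcases eq_or_lt_of_le b.coe_nonneg with h | h
      · simp [← h]
      · rw [Set.inter_eq_left.2 fun t ht => Set.mem_Ioi.2 (lt_of_lt_of_le (half_pos h) ht.1),
          Real.volume_Ico]
        congr 1
        ring
    calc (b : ℝ≥0∞) ^ 2 = 4 * (ENNReal.ofReal (b / 2) * ENNReal.ofReal (b / 2)) := by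
          rw [← ENNReal.ofReal_mul (by positivity),
            ← ENNReal.ofReal_ofNat, ← ENNReal.ofReal_mul (by norm_num),
            ← ENNReal.ofReal_coe_nnreal, ← ENNReal.ofReal_pow b.coe_nonneg]
          congr 1
          ring
      _ = 4 * ∫⁻ _ in Set.Ico ((b : ℝ) / 2) b ∩ Set.Ioi 0, ENNReal.ofReal (b / 2) := by
          rw [setLIntegral_const, hvol]
      _ ≤ 4 * ∫⁻ t in Set.Ico ((b : ℝ) / 2) b ∩ Set.Ioi 0,
            ENNReal.ofReal t * (if ENNReal.ofReal t < a then 1 else 0) := by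
          refine mul_le_mul_right ?_ _
          refine setLIntegral_mono' (measurableSet_Ico.inter measurableSet_Ioi) fun t ht => ?_
          have : ENNReal.ofReal t < a := by
            refine lt_of_lt_of_le ?_ hb
            rw [← ENNReal.ofReal_coe_nnreal]
            exact (ENNReal.ofReal_lt_ofReal_iff (lt_trans ht.2 ht.1.2)).2 ht.1.2
          rw [if_pos this, mul_one]
          exact ENNReal.ofReal_le_ofReal ht.1.1
      _ ≤ _ := by
          gcongr
  refine le_of_forall_lt fun c hc => ?_
  have hcont : (⨆ (b : ℝ≥0) (_ : (b : ℝ≥0∞) ≤ a), (b : ℝ≥0∞)) = a := by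
    refine le_antisymm (iSup₂_le fun b hb => hb) (le_of_forall_lt fun c hc => ?_)
    obtain ⟨b, hb, hba⟩ := ENNReal.lt_iff_exists_nnreal_btwn.1 hc
    exact lt_of_lt_of_le hb (le_iSup₂_of_le b hba.le le_rfl)
  rw [← hcont, ENNReal.iSup_pow_of_ne_zero two_ne_zero, lt_iSup_iff] at hc
  obtain ⟨b, hc⟩ := hc
  rw [ENNReal.iSup_pow_of_ne_zero two_ne_zero, lt_iSup_iff] at hc
  obtain ⟨hb, hc⟩ := hc
  exact hc.trans_le (key b hb)

theorem lintegral_layers_le (a : ℝ≥0∞) :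
    ∫⁻ t in Set.Ioi (0 : ℝ), (if ENNReal.ofReal t < a then 1 else 0) ≤ a := by
  induction a with
  | top => exact le_top
  | coe a =>
    have h : ∀ t ∈ Set.Ioi (0 : ℝ), (if ENNReal.ofReal t < a then 1 else 0 : ℝ≥0∞) ≤
        (Set.Ioo (0 : ℝ) a).indicator 1 t := by
      intro t ht
      split_ifs with hta
      · rw [Set.indicator_of_mem]
        · rfl
        refine ⟨ht, ?_⟩
        rw [← ENNReal.ofReal_coe_nnreal] at hta
        exact (ENNReal.ofReal_lt_ofReal_iff_of_nonneg (Set.mem_Ioi.1 ht).le).1 hta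
      · exact zero_le
    refine (setLIntegral_mono' measurableSet_Ioi h).trans ?_
    refine (setLIntegral_le_lintegral _ _).trans ?_
    rw [lintegral_indicator_one measurableSet_Ioo, Real.volume_Ioo]
    simp

/-- If the average of `f` over `Q`, normalized by the measure of a dilate, exceeds `t`, then the
part of `f` above `t / 2` carries a fixed portion of that measure. -/
theorem mul_measure_dilate_le (σ : Measure (Fin n → ℝ)) [IsLocallyFiniteMeasure σ] {Λ : ℝ}
    (hΛ : 1 ≤ Λ) {f : (Fin n → ℝ) → ℝ≥0∞} (Q : Cube n) {t : ℝ≥0∞} (ht : t ≠ ∞)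
    (h : t < (∫⁻ x in Q.toSet, f x ∂σ) / σ (Q.dilate Λ)) :
    t * σ (Q.dilate Λ) ≤ 2 * ∫⁻ x in Q.toSet, f x * (if t < 2 * f x then 1 else 0) ∂σ := by
  have hfin : t * σ (Q.dilate Λ) ≠ ∞ :=
    ENNReal.mul_ne_top ht (Q.measure_dilate_ne_top (by linarith) σ)
  set J := ∫⁻ x in Q.toSet, f x * (if t < 2 * f x then 1 else 0) ∂σ
  have hf : ∀ x, f x ≤ f x * (if t < 2 * f x then 1 else 0) + t / 2 := by
    intro x
    split_ifs with hx
    · simp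
    · rw [mul_zero, zero_add, ENNReal.le_div_iff_mul_le (by simp) (by simp), mul_comm]
      exact not_lt.1 hx
  have hI : t * σ (Q.dilate Λ) ≤ J + t / 2 * σ (Q.dilate Λ) :=
    calc t * σ (Q.dilate Λ) ≤ ∫⁻ x in Q.toSet, f x ∂σ := ENNReal.mul_le_of_le_div h.le
      _ ≤ ∫⁻ x in Q.toSet, (f x * (if t < 2 * f x then 1 else 0) + t / 2) ∂σ :=
          lintegral_mono hf
      _ = J + t / 2 * σ Q.toSet := by
          rw [lintegral_add_right _ measurable_const, setLIntegral_const]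
      _ ≤ J + t / 2 * σ (Q.dilate Λ) := by
          gcongr
          exact Q.toSet_subset_dilate hΛ
  refine (ENNReal.add_le_add_iff_right hfin).1 ?_
  calc t * σ (Q.dilate Λ) + t * σ (Q.dilate Λ) = 2 * (t * σ (Q.dilate Λ)) := (two_mul _).symm
    _ ≤ 2 * (J + t / 2 * σ (Q.dilate Λ)) := by gcongr
    _ = 2 * J + t * σ (Q.dilate Λ) := by
        rw [mul_add, ← mul_assoc 2 (t / 2), ENNReal.mul_div_cancel (by simp) (by simp)]

theorem lintegral_level_le (σ ω : Measure (Fin n → ℝ)) [IsLocallyFiniteMeasure σ]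
    {Γ : ℝ} (hΓ : 1 < Γ) {T : ℝ≥0∞}
    (hT : ∀ Q : Cube n, Q.memP →
      ∫⁻ x in Q.toSet, (maximal (σ.restrict Q.toSet) x) ^ 2 ∂ω ≤ T ^ 2 * σ (Q.dilate Γ))
    {p : ℕ} (hp : 8 * Γ ≤ 2 ^ p) (f : (Fin n → ℝ) → ℝ≥0∞)
    (F : Finset (ℤ × (Fin n → ℤ))) {t : ℝ≥0∞} (ht : t ≠ ∞) :
    t * ∫⁻ x, ⨆ q ∈ F,
      (if t < (∫⁻ y in (dyadic q).toSet, f y ∂σ) / σ ((dyadic q).dilate (8 * Γ)) then 1 else 0) *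
        ((dyadic q).dilate 3).indicator
          (fun _ => (σ ((dyadic q).dilate (8 * Γ)) / volume (dyadic q).toSet) ^ 2) x ∂ω ≤
      (2 ^ (p * n)) ^ 2 * (T ^ 2 + (2 ^ (p * n)) ^ 2 * A2 σ ω) *
        (2 * ∫⁻ x, f x * (if t < 2 * f x then 1 else 0) ∂σ) := by
  classical
  set K := (2 ^ (p * n)) ^ 2 * (T ^ 2 + (2 ^ (p * n)) ^ 2 * A2 σ ω)
  set v : ℤ × (Fin n → ℤ) → (Fin n → ℝ) → ℝ≥0∞ := fun q => ((dyadic q).dilate 3).indicator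
    (fun _ => (σ ((dyadic q).dilate (8 * Γ)) / volume (dyadic q).toSet) ^ 2)
  have hvm : ∀ q, Measurable (v q) := fun q =>
    measurable_const.indicator ((dyadic q).measurableSet_dilate (by norm_num))
  set S := F.filter fun q =>
    t < (∫⁻ y in (dyadic q).toSet, f y ∂σ) / σ ((dyadic q).dilate (8 * Γ))
  obtain ⟨S', hS', hdisj, hmax⟩ := exists_disjoint_maximal S
  let H : ℤ × (Fin n → ℤ) → (Fin n → ℝ) → ℝ≥0∞ := fun r x =>
    ⨆ q ∈ F.filter fun q => (dyadic q).Within (dyadic r), v q x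
  have hHm : ∀ r, Measurable (H r) := fun r =>
    Measurable.iSup fun q => Measurable.iSup fun _ => hvm q
  have hH : ∀ r, ∫⁻ x, H r x ∂ω ≤ K * σ ((dyadic r).dilate (8 * Γ)) := by
    intro r
    refine le_trans ?_ (setLIntegral_localized_le σ ω hΓ hT hp (memP_dyadic r))
    rw [← lintegral_indicator ((dyadic r).measurableSet_dilate (by norm_num))]
    refine lintegral_mono fun x => iSup₂_le fun q hq => ?_
    refine Set.indicator_apply_le fun hx => ?_
    have hw := (Finset.mem_filter.1 hq).2
    rw [Set.indicator_of_mem (hw.dilate_subset (by norm_num) hx)]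
    exact dilate_average_sq_le σ (by linarith) hp (memP_dyadic q) hw hx
  have hpoint : ∀ x, (⨆ q ∈ F, (if t < (∫⁻ y in (dyadic q).toSet, f y ∂σ) /
      σ ((dyadic q).dilate (8 * Γ)) then 1 else 0) * v q x) ≤ ∑ r ∈ S', H r x := by
    refine fun x => iSup₂_le fun q hq => ?_
    split_ifs with hqt
    · obtain ⟨r, hr, hw⟩ := hmax q (Finset.mem_filter.2 ⟨hq, hqt⟩)
      rw [one_mul]
      refine le_trans ?_ (Finset.single_le_sum (f := fun r => H r x) (fun _ _ => zero_le) hr)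
      exact le_iSup₂_of_le q (Finset.mem_filter.2 ⟨hq, hw⟩) le_rfl
    · simp
  calc _ ≤ t * ∫⁻ x, ∑ r ∈ S', H r x ∂ω := mul_le_mul_right (lintegral_mono hpoint) _
    _ = t * ∑ r ∈ S', ∫⁻ x, H r x ∂ω := by rw [lintegral_finsetSum _ fun r _ => hHm r]
    _ ≤ t * ∑ r ∈ S', K * σ ((dyadic r).dilate (8 * Γ)) := by
        gcongr with r
        exact hH r
    _ = K * ∑ r ∈ S', t * σ ((dyadic r).dilate (8 * Γ)) := by
        rw [← Finset.mul_sum, ← Finset.mul_sum, mul_left_comm]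
    _ ≤ K * ∑ r ∈ S', 2 * ∫⁻ x in (dyadic r).toSet, f x * (if t < 2 * f x then 1 else 0) ∂σ := by
        refine mul_le_mul_right (Finset.sum_le_sum fun r hr => ?_) _
        exact mul_measure_dilate_le σ (by linarith) _ ht (Finset.mem_filter.1 (hS' hr)).2
    _ = K * (2 * ∫⁻ x in ⋃ r ∈ S', (dyadic r).toSet,
          f x * (if t < 2 * f x then 1 else 0) ∂σ) := by
        rw [← Finset.mul_sum,
          lintegral_biUnion_finset hdisj fun r _ => (dyadic r).measurableSet_toSet]
    _ ≤ _ := by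
        gcongr
        exact Measure.restrict_le_self

/-- The dyadic estimate for finite families of cubes. -/
theorem lintegral_biSup_dyadic_le (σ ω : Measure (Fin n → ℝ)) [IsLocallyFiniteMeasure σ]
    [IsLocallyFiniteMeasure ω] {Γ : ℝ} (hΓ : 1 < Γ) {T : ℝ≥0∞}
    (hT : ∀ Q : Cube n, Q.memP →
      ∫⁻ x in Q.toSet, (maximal (σ.restrict Q.toSet) x) ^ 2 ∂ω ≤ T ^ 2 * σ (Q.dilate Γ))
    {p : ℕ} (hp : 8 * Γ ≤ 2 ^ p) {f : (Fin n → ℝ) → ℝ≥0∞} (hf : Measurable f)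
    (F : Finset (ℤ × (Fin n → ℤ))) :
    ∫⁻ x, ⨆ q ∈ F, ((dyadic q).dilate 3).indicator
        (fun _ => ((∫⁻ y in (dyadic q).toSet, f y ∂σ) / volume (dyadic q).toSet) ^ 2) x ∂ω ≤
      16 * ((2 ^ (p * n)) ^ 2 * (T ^ 2 + (2 ^ (p * n)) ^ 2 * A2 σ ω)) * ∫⁻ x, f x ^ 2 ∂σ := by
  set K := (2 ^ (p * n)) ^ 2 * (T ^ 2 + (2 ^ (p * n)) ^ 2 * A2 σ ω)
  let a : ℤ × (Fin n → ℤ) → ℝ≥0∞ := fun q =>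
    (∫⁻ y in (dyadic q).toSet, f y ∂σ) / σ ((dyadic q).dilate (8 * Γ))
  let v : ℤ × (Fin n → ℤ) → (Fin n → ℝ) → ℝ≥0∞ := fun q => ((dyadic q).dilate 3).indicator
    (fun _ => (σ ((dyadic q).dilate (8 * Γ)) / volume (dyadic q).toSet) ^ 2)
  let h : ℝ → (Fin n → ℝ) → ℝ≥0∞ := fun t x =>
    ⨆ q ∈ F, (if ENNReal.ofReal t < a q then 1 else 0) * v q x
  have hvm : ∀ q, Measurable (v q) := fun q =>
    measurable_const.indicator ((dyadic q).measurableSet_dilate (by norm_num))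
  have hhm : Measurable fun z : (Fin n → ℝ) × ℝ => ENNReal.ofReal z.2 * h z.2 z.1 := by
    refine (ENNReal.measurable_ofReal.comp measurable_snd).mul ?_
    refine Measurable.iSup fun q => Measurable.iSup fun _ => Measurable.mul ?_
      ((hvm q).comp measurable_fst)
    exact Measurable.ite (measurableSet_lt (ENNReal.measurable_ofReal.comp measurable_snd)
      measurable_const) measurable_const measurable_const
  have hfm : Measurable fun z : ℝ × (Fin n → ℝ) =>
      f z.2 * (if ENNReal.ofReal z.1 < 2 * f z.2 then 1 else 0) :=
    (hf.comp measurable_snd).mul (Measurable.ite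
      (measurableSet_lt (ENNReal.measurable_ofReal.comp measurable_fst)
        ((hf.comp measurable_snd).const_mul 2)) measurable_const measurable_const)
  have havg : ∀ q, (∫⁻ y in (dyadic q).toSet, f y ∂σ) / volume (dyadic q).toSet =
      σ ((dyadic q).dilate (8 * Γ)) / volume (dyadic q).toSet * a q := by
    intro q
    have hcancel : σ ((dyadic q).dilate (8 * Γ)) * a q = ∫⁻ y in (dyadic q).toSet, f y ∂σ := by
      refine ENNReal.mul_div_cancel' (fun h0 => ?_)
        (fun h0 => absurd h0 ((dyadic q).measure_dilate_ne_top (by linarith) σ))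
      exact setLIntegral_measure_zero _ _
        (measure_mono_null ((dyadic q).toSet_subset_dilate (by linarith)) h0)
    rw [← hcancel]
    simp only [div_eq_mul_inv]
    ring
  have hpoint : ∀ x, (⨆ q ∈ F, ((dyadic q).dilate 3).indicator
      (fun _ => ((∫⁻ y in (dyadic q).toSet, f y ∂σ) / volume (dyadic q).toSet) ^ 2) x) ≤
      4 * ∫⁻ t in Set.Ioi (0 : ℝ), ENNReal.ofReal t * h t x := by
    refine fun x => iSup₂_le fun q hq => Set.indicator_apply_le' (fun hx => ?_) fun _ => zero_le
    rw [havg, mul_pow]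
    refine (mul_le_mul_right (sq_le_lintegral_layers (a q)) _).trans ?_
    rw [mul_left_comm, ← lintegral_const_mul]
    · refine mul_le_mul_right (lintegral_mono fun t => ?_) _
      rw [mul_left_comm]
      refine mul_le_mul_right (le_iSup₂_of_le q hq ?_) _
      simp only [v, Set.indicator_of_mem hx]
      rw [mul_comm]
    · exact ENNReal.measurable_ofReal.mul (Measurable.ite
        (measurableSet_lt ENNReal.measurable_ofReal measurable_const)
        measurable_const measurable_const)
  calc _ ≤ ∫⁻ x, 4 * (∫⁻ t in Set.Ioi (0 : ℝ), ENNReal.ofReal t * h t x) ∂ω :=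
        lintegral_mono hpoint
    _ = 4 * ∫⁻ t in Set.Ioi (0 : ℝ), ENNReal.ofReal t * ∫⁻ x, h t x ∂ω := by
        rw [lintegral_const_mul' _ _ (by simp), lintegral_lintegral_swap hhm.aemeasurable]
        congr 2
        funext t
        rw [lintegral_const_mul' _ _ ENNReal.ofReal_ne_top]
    _ ≤ 4 * ∫⁻ t in Set.Ioi (0 : ℝ),
          K * (2 * ∫⁻ x, f x * (if ENNReal.ofReal t < 2 * f x then 1 else 0) ∂σ) :=
        mul_le_mul_right (lintegral_mono fun t =>
          lintegral_level_le σ ω hΓ hT hp f F ENNReal.ofReal_ne_top) _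
    _ = 4 * (K * (2 * ∫⁻ x, f x *
          (∫⁻ t in Set.Ioi (0 : ℝ), (if ENNReal.ofReal t < 2 * f x then 1 else 0)) ∂σ)) := by
        have hm := hfm.lintegral_prod_right' (ν := σ)
        rw [lintegral_const_mul _ (hm.const_mul 2), lintegral_const_mul _ hm,
          lintegral_lintegral_swap hfm.aemeasurable]
        congr 4
        funext x
        dsimp only
        exact lintegral_const_mul _ (Measurable.ite
          (measurableSet_lt ENNReal.measurable_ofReal measurable_const)
          measurable_const measurable_const)
    _ ≤ 4 * (K * (2 * ∫⁻ x, f x * (2 * f x) ∂σ)) := by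
        gcongr with x
        exact lintegral_layers_le _
    _ = 16 * K * ∫⁻ x, f x ^ 2 ∂σ := by
        rw [show (fun x => f x * (2 * f x)) = fun x => 2 * f x ^ 2 by funext x; ring,
          lintegral_const_mul' _ _ (by simp)]
        ring

theorem lintegral_maximal_sq_le (σ ω : Measure (Fin n → ℝ)) [IsLocallyFiniteMeasure σ]
    [IsLocallyFiniteMeasure ω] {Γ : ℝ} (hΓ : 1 < Γ) {T : ℝ≥0∞}
    (hT : ∀ Q : Cube n, Q.memP →
      ∫⁻ x in Q.toSet, (maximal (σ.restrict Q.toSet) x) ^ 2 ∂ω ≤ T ^ 2 * σ (Q.dilate Γ))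
    {p : ℕ} (hp : 8 * Γ ≤ 2 ^ p) {f : (Fin n → ℝ) → ℝ≥0∞} (hf : Measurable f) :
    ∫⁻ x, maximal (σ.withDensity f) x ^ 2 ∂ω ≤
      (2 ^ n) ^ 2 * (16 * ((2 ^ (p * n)) ^ 2 * (T ^ 2 + (2 ^ (p * n)) ^ 2 * A2 σ ω)) *
        ∫⁻ x, f x ^ 2 ∂σ) := by
  let u : ℤ × (Fin n → ℤ) → (Fin n → ℝ) → ℝ≥0∞ := fun q => ((dyadic q).dilate 3).indicator
    (fun _ => (∫⁻ y in (dyadic q).toSet, f y ∂σ) / volume (dyadic q).toSet)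
  let w : ℤ × (Fin n → ℤ) → (Fin n → ℝ) → ℝ≥0∞ := fun q => ((dyadic q).dilate 3).indicator
    (fun _ => ((∫⁻ y in (dyadic q).toSet, f y ∂σ) / volume (dyadic q).toSet) ^ 2)
  have hwm : ∀ q, Measurable (w q) := fun q =>
    measurable_const.indicator ((dyadic q).measurableSet_dilate (by norm_num))
  have huw : ∀ q x, u q x ^ 2 = w q x := by
    intro q x
    by_cases hx : x ∈ (dyadic q).dilate 3 <;> simp [u, w, hx]
  have hM : ∀ x, maximal (σ.withDensity f) x ^ 2 ≤
      (2 ^ n) ^ 2 * ⨆ F : Finset _, ⨆ q ∈ F, w q x := by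
    intro x
    rw [← iSup_eq_iSup_finset]
    simp_rw [← huw]
    rw [← ENNReal.iSup_pow_of_ne_zero two_ne_zero, ← mul_pow]
    refine pow_le_pow_left₀ zero_le ?_ 2
    refine iSup₂_le fun P hP => iSup_le fun hx => average_le_of_dyadic _ hP hx fun q hq => ?_
    refine le_iSup_of_le q ?_
    simp only [u, Set.indicator_of_mem hq]
    rw [withDensity_apply _ (measurableSet_toSet _)]
  refine (lintegral_mono hM).trans ?_
  rw [lintegral_const_mul' _ _ (by finiteness), lintegral_iSup_directed]
  · refine mul_le_mul_right (iSup_le fun F => ?_) _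
    exact lintegral_biSup_dyadic_le σ ω hΓ hT hp hf F
  · exact fun F => (Measurable.iSup fun q => Measurable.iSup fun _ => hwm q).aemeasurable
  · refine Monotone.directed_le fun F G hFG x => ?_
    exact biSup_mono fun q hq => hFG hq

theorem lintegral_maximal_restrict_sq_le {σ ω : Measure (Fin n → ℝ)} {N : ℝ≥0∞}
    (hN : ∀ f : (Fin n → ℝ) → ℝ≥0∞, Measurable f →
      ∫⁻ x, (maximal (σ.withDensity f) x) ^ 2 ∂ω ≤ N ^ 2 * ∫⁻ x, (f x) ^ 2 ∂σ) (Q : Cube n) :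
    ∫⁻ x in Q.toSet, (maximal (σ.restrict Q.toSet) x) ^ 2 ∂ω ≤ N ^ 2 * σ Q.toSet := by
  have h := hN (Q.toSet.indicator 1) (measurable_one.indicator Q.measurableSet_toSet)
  rw [withDensity_indicator_one Q.measurableSet_toSet] at h
  have hsq : (fun x => (Q.toSet.indicator (1 : (Fin n → ℝ) → ℝ≥0∞) x) ^ 2) =
      Q.toSet.indicator 1 := by
    funext x
    by_cases hx : x ∈ Q.toSet <;> simp [hx]
  rw [hsq, lintegral_indicator_one Q.measurableSet_toSet] at h
  exact (setLIntegral_le_lintegral _ _).trans h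

theorem testGamma_le_opNorm {Γ : ℝ} (hΓ : 1 < Γ) (σ ω : Measure (Fin n → ℝ)) :
    testGamma Γ σ ω ≤ opNorm σ ω := by
  refine le_sInf fun N hN => sInf_le fun Q _ => ?_
  refine (lintegral_maximal_restrict_sq_le hN Q).trans ?_
  gcongr
  exact Q.toSet_subset_dilate hΓ.le

theorem sqrt_A2_le_opNorm (σ ω : Measure (Fin n → ℝ)) [IsLocallyFiniteMeasure σ] :
    A2 σ ω ^ ((1 : ℝ) / 2) ≤ opNorm σ ω := by
  refine le_sInf fun N hN => ?_
  rw [one_div, ENNReal.rpow_inv_le_iff two_pos, ENNReal.rpow_two]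
  refine iSup₂_le fun Q hQ => ?_
  rcases eq_or_ne (σ Q.toSet) 0 with h0 | h0
  · simp [h0]
  have h : (σ Q.toSet / volume Q.toSet) ^ 2 * ω Q.toSet ≤ N ^ 2 * σ Q.toSet := by
    refine le_trans ?_ (lintegral_maximal_restrict_sq_le hN Q)
    rw [← setLIntegral_const]
    refine setLIntegral_mono' Q.measurableSet_toSet fun x hx => pow_le_pow_left₀ zero_le ?_ 2
    have := le_maximal (σ.restrict Q.toSet) hQ hx
    rwa [Measure.restrict_apply_self] at this
  refine (ENNReal.mul_le_mul_iff_left h0 (Q.measure_ne_top σ)).1 (le_trans (le_of_eq ?_) h)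
  simp only [div_eq_mul_inv]
  ring

theorem opNorm_le_of_testing (σ ω : Measure (Fin n → ℝ)) [IsLocallyFiniteMeasure σ]
    [IsLocallyFiniteMeasure ω] {Γ : ℝ} (hΓ : 1 < Γ) {p : ℕ} (hp : 8 * Γ ≤ 2 ^ p) :
    opNorm σ ω ≤ 2 ^ n * 4 * (2 ^ (p * n)) ^ 2 * (testGamma Γ σ ω + A2 σ ω ^ ((1 : ℝ) / 2)) := by
  have hC : (2 ^ n * 4 * (2 ^ (p * n)) ^ 2 : ℝ≥0∞) ≠ ∞ := by finiteness
  rw [testGamma, ENNReal.sInf_add, ENNReal.mul_iInf_of_ne (by simp) hC]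
  refine le_iInf fun T => ?_
  rw [ENNReal.mul_iInf_of_ne (by simp) hC]
  refine le_iInf fun hT => sInf_le fun f hf => ?_
  refine (lintegral_maximal_sq_le σ ω hΓ hT hp hf).trans ?_
  rw [← mul_assoc]
  refine mul_le_mul_left ?_ _
  set S := A2 σ ω ^ ((1 : ℝ) / 2) with hS
  have hA : A2 σ ω = S ^ 2 := by
    rw [hS, ← ENNReal.rpow_two, ← ENNReal.rpow_mul]
    norm_num
  have hone : (1 : ℝ≥0∞) ≤ (2 ^ (p * n)) ^ 2 := one_le_pow₀ (one_le_pow₀ one_le_two)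
  rw [hA]
  generalize ((2 : ℝ≥0∞) ^ (p * n)) ^ 2 = B at *
  calc (2 ^ n) ^ 2 * (16 * (B * (T ^ 2 + B * S ^ 2)))
      ≤ (2 ^ n) ^ 2 * (16 * (B * (B * T ^ 2 + B * S ^ 2 + 2 * B * T * S))) := by
        rw [add_assoc]
        gcongr
        · exact le_mul_of_one_le_left zero_le hone
        · exact le_self_add
    _ = (2 ^ n * 4 * B * (T + S)) ^ 2 := by ring

end MaximalEstimates

/-- **Theorem 2 (strong `Γ`-testing).** For every `Γ > 1` and all pairs `(σ,ω)` of locally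
finite positive Borel measures on `ℝⁿ`,
`𝔑_M(σ,ω) ≈ 𝔗_M(Γ)(σ,ω) + √A₂(σ,ω)`, with implicit constants of comparability
depending only on `Γ` and the dimension `n`. -/
theorem maximal_norm_equiv_gamma_testing
    {n : ℕ} (Γ : ℝ) (hΓ : 1 < Γ) :
    ∃ C : ℝ≥0∞, 0 < C ∧ C ≠ ⊤ ∧
      ∀ σ ω : Measure (Fin n → ℝ),
        IsLocallyFiniteMeasure σ → IsLocallyFiniteMeasure ω →
        opNorm σ ω ≤ C * (testGamma Γ σ ω + A2 σ ω ^ ((1:ℝ)/2)) ∧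
        testGamma Γ σ ω + A2 σ ω ^ ((1:ℝ)/2) ≤ C * opNorm σ ω := by
  obtain ⟨p, hp⟩ := pow_unbounded_of_one_lt (8 * Γ) (one_lt_two : (1 : ℝ) < 2)
  refine ⟨2 ^ n * 4 * (2 ^ (p * n)) ^ 2, by positivity, by finiteness, fun σ ω _ _ =>
    ⟨opNorm_le_of_testing σ ω hΓ hp.le, ?_⟩⟩
  refine (add_le_add (testGamma_le_opNorm hΓ σ ω) (sqrt_A2_le_opNorm σ ω)).trans ?_
  rw [← two_mul]
  gcongr
  have h₁ : (1 : ℝ≥0∞) ≤ 2 ^ n := one_le_pow₀ one_le_two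
  have h₂ : (1 : ℝ≥0∞) ≤ (2 ^ (p * n)) ^ 2 := one_le_pow₀ (one_le_pow₀ one_le_two)
  calc (2 : ℝ≥0∞) ≤ 1 * 4 * 1 := by norm_num
    _ ≤ _ := by gcongr
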